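/- If X₁ and X₂ are nonempty subsets of a metric space X, each endowed with the metric induced from X, then d∞(X₁ ∪ X₂) = max{ d∞(X₁), d∞(X₂) }. -/

import Mathlib

open Metric Filter Set
open scoped ENNReal

/-- Least number of open balls of radius `r` (arbitrary centres) needed to cover `Ω`;
`⊤` if no finite cover exists. -/
noncomputable def coverNum {X : Type*} [MetricSpace X] (r : ℝ) (Ω : Set X) : ℕ∞ :=
  sInf ((fun s : Finset X => (s.card : ℕ∞)) '' {s | Ω ⊆ ⋃ y ∈ s, Metric.ball y r})

/-- Largest number of pairwise disjoint open balls of radius `r` with centres in `Ω`. -/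
noncomputable def packNum {X : Type*} [MetricSpace X] (r : ℝ) (Ω : Set X) : ℕ∞ :=
  sSup ((fun s : Finset X => (s.card : ℕ∞)) ''
    {s | ↑s ⊆ Ω ∧ (s : Set X).Pairwise fun a b => Disjoint (Metric.ball a r) (Metric.ball b r)})

/-- Logarithm of an extended natural number, valued in `[0,∞]`. -/
noncomputable def elog (n : ℕ∞) : ℝ≥0∞ :=
  if n = ⊤ then ⊤ else ENNReal.ofReal (Real.log n.toNat)

/-- The quantity `log n_r(B(x,R)) / log R`. -/
noncomputable def dimRatio {X : Type*} [MetricSpace X] (x : X) (r R : ℝ) : ℝ≥0∞ :=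
  elog (coverNum r (Metric.ball x R)) / ENNReal.ofReal (Real.log R)

/-- The asymptotic dimension computed at the base point `x`:
`lim_{r→∞} limsup_{R→∞} log n_r(B(x,R)) / log R`; since the inner expression is
nonincreasing in `r`, the limit equals the infimum over `r > 0`. -/
noncomputable def asympDimAt {X : Type*} [MetricSpace X] (x : X) : ℝ≥0∞ :=
  ⨅ (r : ℝ) (_ : 0 < r), Filter.limsup (fun R => dimRatio x r R) Filter.atTop

/-- The asymptotic dimension `d∞(X)` of a nonempty metric space. -/
noncomputable def asympDim (X : Type*) [MetricSpace X] [Nonempty X] : ℝ≥0∞ :=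
  asympDimAt (Classical.arbitrary X)

open scoped Topology

lemma elog_mono : Monotone elog := by
  intro m n h
  unfold elog
  by_cases hn : n = ⊤
  · simp [hn]
  have hm : m ≠ ⊤ := ne_top_of_le_ne_top hn h
  rw [if_neg hn, if_neg hm]
  apply ENNReal.ofReal_le_ofReal
  rcases Nat.eq_zero_or_pos m.toNat with h0 | h0
  · rw [h0]
    simpa using Real.log_natCast_nonneg n.toNat
  · exact Real.log_le_log (by exact_mod_cast h0) (by exact_mod_cast ENat.toNat_le_toNat h hn)

lemma elog_two_mul_le (n : ℕ∞) : elog (2 * n) ≤ elog n + ENNReal.ofReal (Real.log 2) := by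
  induction n using ENat.recTopCoe with
  | top => simp [elog]
  | coe n =>
    have h : (2 * (n : ℕ∞)) = ((2 * n : ℕ) : ℕ∞) := by push_cast; rfl
    rw [h]
    simp only [elog, ENat.natCast_ne_top, if_false, ENat.toNat_natCast]
    rcases Nat.eq_zero_or_pos n with rfl | hn
    · simp
    rw [← ENNReal.ofReal_add (Real.log_natCast_nonneg n) (Real.log_nonneg one_le_two)]
    apply ENNReal.ofReal_le_ofReal
    have hn' : (n : ℝ) ≠ 0 := by exact_mod_cast hn.ne'
    push_cast
    rw [Real.log_mul two_ne_zero hn', add_comm]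

lemma elog_add_le (m n : ℕ∞) :
    elog (m + n) ≤ max (elog m) (elog n) + ENNReal.ofReal (Real.log 2) := by
  rw [← elog_mono.map_max]
  refine (elog_mono ?_).trans (elog_two_mul_le _)
  rw [two_mul]
  exact add_le_add (le_max_left _ _) (le_max_right _ _)

lemma tendsto_const_div_ofReal_log (c : ℝ) :
    Tendsto (fun R : ℝ => ENNReal.ofReal c / ENNReal.ofReal (Real.log R)) atTop (𝓝 0) := by
  have h := ENNReal.Tendsto.const_div (a := ENNReal.ofReal c)
    (ENNReal.tendsto_ofReal_nhds_top.2 Real.tendsto_log_atTop) (Or.inr ENNReal.ofReal_ne_top)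
  simpa using h

/-- Translating the radius does not increase the polynomial growth rate. -/
lemma limsup_elog_shift_le (N : ℝ → ℕ∞) {D : ℝ} (hD : 0 ≤ D) :
    limsup (fun R => elog (N (R + D)) / ENNReal.ofReal (Real.log R)) atTop ≤
      limsup (fun R => elog (N R) / ENNReal.ofReal (Real.log R)) atTop := by
  set g : ℝ → ℝ≥0∞ := fun R => elog (N R) / ENNReal.ofReal (Real.log R) with hg
  set c : ℝ → ℝ≥0∞ :=
    fun R => 1 + ENNReal.ofReal (Real.log 2) / ENNReal.ofReal (Real.log R)
  have hc1 : limsup c atTop = 1 := by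
    have h := (tendsto_const_nhds (x := (1 : ℝ≥0∞))).add (tendsto_const_div_ofReal_log (Real.log 2))
    rw [add_zero] at h
    exact h.limsup_eq
  have hshift : limsup (fun R => g (R + D)) atTop ≤ limsup g atTop :=
    (tendsto_atTop_add_const_right atTop D tendsto_id).limsup_comp_le_limsup (u := g)
  calc _ ≤ limsup ((fun R => g (R + D)) * c) atTop := by
        refine limsup_le_limsup ?_
        filter_upwards [eventually_ge_atTop D, eventually_gt_atTop 1] with R hR hR1
        have hlog : 0 < Real.log R := Real.log_pos hR1
        have hlog' : 0 < Real.log (R + D) := Real.log_pos (by linarith)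
        have hle : Real.log (R + D) ≤ Real.log R + Real.log 2 := by
          rw [← Real.log_mul (by positivity) two_ne_zero]
          exact Real.log_le_log (by linarith) (by linarith)
        have h0 : ENNReal.ofReal (Real.log R) ≠ 0 := by simpa using hlog
        have h0' : ENNReal.ofReal (Real.log (R + D)) ≠ 0 := by simpa using hlog'
        have hle' : ENNReal.ofReal (Real.log (R + D)) / ENNReal.ofReal (Real.log R) ≤ c R := by
          change _ ≤ 1 + ENNReal.ofReal (Real.log 2) / ENNReal.ofReal (Real.log R)
          rw [← ENNReal.div_self h0 ENNReal.ofReal_ne_top, ← ENNReal.add_div,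
            ← ENNReal.ofReal_add hlog.le (Real.log_nonneg one_le_two)]
          exact ENNReal.div_le_div_right (ENNReal.ofReal_le_ofReal hle) _
        calc elog (N (R + D)) / ENNReal.ofReal (Real.log R)
            = g (R + D) * (ENNReal.ofReal (Real.log (R + D)) / ENNReal.ofReal (Real.log R)) := by
              rw [hg, ← mul_div_assoc, ENNReal.div_mul_cancel h0' ENNReal.ofReal_ne_top]
          _ ≤ g (R + D) * c R := by gcongr
    _ ≤ limsup (fun R => g (R + D)) atTop * limsup c atTop :=
        ENNReal.limsup_mul_le' (by simp [hc1]) (by simp [hc1])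
    _ ≤ _ := by rw [hc1, mul_one]; exact hshift

section coverNum

variable {X Y Z : Type*} [MetricSpace X] [MetricSpace Y] [MetricSpace Z]

lemma coverNum_le_card {r : ℝ} {Ω : Set X} {s : Finset X} (h : Ω ⊆ ⋃ y ∈ s, ball y r) :
    coverNum r Ω ≤ s.card :=
  sInf_le ⟨s, h, rfl⟩

lemma le_coverNum {r : ℝ} {Ω : Set X} {n : ℕ∞}
    (h : ∀ s : Finset X, Ω ⊆ ⋃ y ∈ s, ball y r → n ≤ s.card) : n ≤ coverNum r Ω := by
  apply le_sInf
  rintro _ ⟨s, hs, rfl⟩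
  exact h s hs

lemma exists_card_eq_coverNum {r : ℝ} {Ω : Set X} (h : coverNum r Ω ≠ ⊤) :
    ∃ s : Finset X, Ω ⊆ (⋃ y ∈ s, ball y r) ∧ (s.card : ℕ∞) = coverNum r Ω := by
  have hne : ((fun s : Finset X => (s.card : ℕ∞)) '' {s | Ω ⊆ ⋃ y ∈ s, ball y r}).Nonempty := by
    by_contra hne
    rw [not_nonempty_iff_eq_empty] at hne
    exact h (by rw [coverNum, hne, sInf_empty])
  exact csInf_mem hne

lemma coverNum_mono {r : ℝ} {Ω Ω' : Set X} (h : Ω ⊆ Ω') : coverNum r Ω ≤ coverNum r Ω' :=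
  le_coverNum fun _ hs => coverNum_le_card (h.trans hs)

lemma coverNum_anti {r r' : ℝ} (h : r ≤ r') (Ω : Set X) : coverNum r' Ω ≤ coverNum r Ω :=
  le_coverNum fun _ hs => coverNum_le_card (hs.trans (iUnion₂_mono fun _ _ => ball_subset_ball h))

lemma coverNum_union_le (r : ℝ) (Ω Ω' : Set X) :
    coverNum r (Ω ∪ Ω') ≤ coverNum r Ω + coverNum r Ω' := by
  classical
  by_cases h : coverNum r Ω = ⊤
  · simp [h]
  by_cases h' : coverNum r Ω' = ⊤
  · simp [h']
  obtain ⟨s, hs, hs'⟩ := exists_card_eq_coverNum h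
  obtain ⟨t, ht, ht'⟩ := exists_card_eq_coverNum h'
  rw [← hs', ← ht']
  refine (coverNum_le_card (s := s ∪ t) ?_).trans (by exact_mod_cast Finset.card_union_le s t)
  rw [Finset.set_biUnion_union]
  exact union_subset_union hs ht

lemma coverNum_image_le {f : Y → Z} (hf : Isometry f) (r : ℝ) (Ω : Set Y) :
    coverNum r (f '' Ω) ≤ coverNum r Ω := by
  classical
  refine le_coverNum fun s hs => (coverNum_le_card (s := s.image f) ?_).trans
    (by exact_mod_cast Finset.card_image_le)
  rintro _ ⟨x, hx, rfl⟩
  obtain ⟨y, hy, hxy⟩ := mem_iUnion₂.1 (hs hx)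
  exact mem_iUnion₂.2 ⟨f y, Finset.mem_image_of_mem f hy, by simpa [hf.dist_eq] using hxy⟩

/-- Doubling the radius lets the centres of a cover of `f '' Ω` be moved into the range of `f`. -/
lemma coverNum_two_mul_le_image {f : Y → Z} (hf : Isometry f) (r : ℝ) (Ω : Set Y) :
    coverNum (2 * r) Ω ≤ coverNum r (f '' Ω) := by
  classical
  rcases isEmpty_or_nonempty Y with hY | hY
  · rw [Subsingleton.elim Ω ∅]
    exact (coverNum_le_card (s := ∅) (by simp)).trans (by simp)
  have hex : ∀ z : Z, ∃ y : Y, (∃ y', f y' ∈ ball z r) → f y ∈ ball z r := by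
    intro z
    by_cases h : ∃ y', f y' ∈ ball z r
    · exact ⟨h.choose, fun _ => h.choose_spec⟩
    · exact ⟨Classical.arbitrary Y, fun h' => absurd h' h⟩
  choose p hp using hex
  refine le_coverNum fun s hs => (coverNum_le_card (s := s.image p) ?_).trans
    (by exact_mod_cast Finset.card_image_le)
  intro x hx
  obtain ⟨z, hz, hxz⟩ := mem_iUnion₂.1 (hs (mem_image_of_mem f hx))
  refine mem_iUnion₂.2 ⟨p z, Finset.mem_image_of_mem p hz, ?_⟩
  have h₁ := hp z ⟨x, hxz⟩
  rw [mem_ball] at h₁ hxz ⊢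
  rw [← hf.dist_eq]
  linarith [dist_triangle_right (f x) (f (p z)) z]

lemma dimRatio_anti {r r' : ℝ} (h : r ≤ r') (x : X) (R : ℝ) : dimRatio x r' R ≤ dimRatio x r R :=
  ENNReal.div_le_div_right (elog_mono (coverNum_anti h _)) _

lemma asympDimAt_le_limsup (x : X) {r : ℝ} (hr : 0 < r) :
    asympDimAt x ≤ limsup (fun R => dimRatio x r R) atTop :=
  iInf₂_le r hr

lemma asympDimAt_le_of_isometry {f : Y → Z} (hf : Isometry f) (y : Y) (z : Z) :
    asympDimAt y ≤ asympDimAt z := by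
  refine le_iInf₂ fun r hr => (asympDimAt_le_limsup y (mul_pos two_pos hr)).trans ?_
  refine le_trans (limsup_le_limsup (Eventually.of_forall fun R => ?_))
    (limsup_elog_shift_le (fun R => coverNum r (ball z R)) (dist_nonneg (x := f y) (y := z)))
  refine ENNReal.div_le_div_right (elog_mono ?_) _
  refine (coverNum_two_mul_le_image hf r _).trans (coverNum_mono ?_)
  rintro _ ⟨x, hx, rfl⟩
  rw [mem_ball] at hx ⊢
  rw [← hf.dist_eq] at hx
  linarith [dist_triangle (f x) (f y) z]

lemma asympDimAt_le_max {f : X → Z} {g : Y → Z} (hf : Isometry f) (hg : Isometry g)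
    (hfg : range f ∪ range g = univ) (x : X) (y : Y) (z : Z) :
    asympDimAt z ≤ max (asympDimAt x) (asympDimAt y) := by
  have key : ∀ r : ℝ, 0 < r → asympDimAt z ≤
      max (limsup (fun R => dimRatio x r R) atTop) (limsup (fun R => dimRatio y r R) atTop) := by
    intro r hr
    set N : ℝ → ℕ∞ := fun R => coverNum r (ball x R)
    set M : ℝ → ℕ∞ := fun R => coverNum r (ball y R)
    set D := dist (f x) z
    set E := dist (g y) z
    have hcover : ∀ R, coverNum r (ball z R) ≤ N (R + D) + M (R + E) := by
      intro R
      refine (coverNum_mono ?_).trans ((coverNum_union_le r (f '' ball x (R + D))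
        (g '' ball y (R + E))).trans (add_le_add (coverNum_image_le hf _ _)
          (coverNum_image_le hg _ _)))
      intro w hw
      rw [mem_ball] at hw
      have hw' : w ∈ range f ∪ range g := hfg ▸ mem_univ w
      rcases hw' with ⟨a, rfl⟩ | ⟨a, rfl⟩
      · refine Or.inl ⟨a, ?_, rfl⟩
        rw [mem_ball, ← hf.dist_eq]
        linarith [dist_triangle_right (f a) (f x) z]
      · refine Or.inr ⟨a, ?_, rfl⟩
        rw [mem_ball, ← hg.dist_eq]
        linarith [dist_triangle_right (g a) (g y) z]
    set u : ℝ → ℝ≥0∞ := fun R => elog (N (R + D)) / ENNReal.ofReal (Real.log R)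
    set v : ℝ → ℝ≥0∞ := fun R => elog (M (R + E)) / ENNReal.ofReal (Real.log R)
    set e : ℝ → ℝ≥0∞ := fun R => ENNReal.ofReal (Real.log 2) / ENNReal.ofReal (Real.log R)
    have hle : ∀ R, dimRatio z r R ≤ ((fun R => max (u R) (v R)) + e) R := by
      intro R
      have hmono : Monotone fun a : ℝ≥0∞ => a / ENNReal.ofReal (Real.log R) :=
        fun _ _ h => ENNReal.div_le_div_right h _
      change _ ≤ max (u R) (v R) + e R
      rw [← hmono.map_max, ← ENNReal.add_div]
      exact hmono ((elog_mono (hcover R)).trans (elog_add_le _ _))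
    have he : Tendsto e atTop (𝓝 0) := tendsto_const_div_ofReal_log (Real.log 2)
    calc asympDimAt z ≤ limsup (fun R => dimRatio z r R) atTop := asympDimAt_le_limsup z hr
      _ ≤ limsup ((fun R => max (u R) (v R)) + e) atTop :=
          limsup_le_limsup (Eventually.of_forall hle)
      _ = limsup (fun R => max (u R) (v R)) atTop :=
          ENNReal.limsup_add_of_right_tendsto_zero he _
      _ = max (limsup u atTop) (limsup v atTop) := limsup_max
      _ ≤ _ := max_le_max (limsup_elog_shift_le N dist_nonneg)
          (limsup_elog_shift_le M dist_nonneg)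
  refine le_of_forall_gt fun c hc => ?_
  obtain ⟨hx, hy⟩ := max_lt_iff.1 hc
  simp only [asympDimAt, iInf_lt_iff] at hx hy
  obtain ⟨r, hr, hrc⟩ := hx
  obtain ⟨t, ht, htc⟩ := hy
  refine (key (max r t) (hr.trans_le (le_max_left _ _))).trans_lt (max_lt ?_ ?_)
  · exact (limsup_le_limsup (Eventually.of_forall
      fun R => dimRatio_anti (le_max_left r t) x R)).trans_lt hrc
  · exact (limsup_le_limsup (Eventually.of_forall
      fun R => dimRatio_anti (le_max_right r t) y R)).trans_lt htc

end coverNum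

/-- For nonempty subsets `X₁, X₂` of a metric space `X` (with the induced metrics),
`d∞(X₁ ∪ X₂) = max (d∞ X₁) (d∞ X₂)`. -/
theorem asympDim_union {X : Type*} [MetricSpace X] (X₁ X₂ : Set X)
    [Nonempty X₁] [Nonempty X₂] [Nonempty ↥(X₁ ∪ X₂)] :
    asympDim ↥(X₁ ∪ X₂) = max (asympDim X₁) (asympDim X₂) := by
  have h₁ : Isometry (inclusion (subset_union_left : X₁ ⊆ X₁ ∪ X₂)) := fun _ _ => rfl
  have h₂ : Isometry (inclusion (subset_union_right : X₂ ⊆ X₁ ∪ X₂)) := fun _ _ => rfl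
  refine le_antisymm (asympDimAt_le_max h₁ h₂ ?_ _ _ _)
    (max_le (asympDimAt_le_of_isometry h₁ _ _) (asympDimAt_le_of_isometry h₂ _ _))
  refine eq_univ_of_forall fun ⟨x, hx⟩ => ?_
  rcases hx with hx | hx
  · exact Or.inl ⟨⟨x, hx⟩, rfl⟩
  · exact Or.inr ⟨⟨x, hx⟩, rfl⟩
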